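/- Let w be a word of length n, f(i) = π_w[i−1] + 1 and f'(i) = π'_w[i−1] + 1 for 2 ≤ i ≤ n (f'(i) is defined only when π'_w[i−1] ≥ 0, i.e., f'(i) ≥ 1; iterates f'^{(k)} are defined while all intermediate values are ≥ 2). Then for every index 2 ≤ i ≤ n, either π_w[i] = f(i), or π_w[i] = 0, or π_w[i] = f'^{(k)}(i) for some k ≥ 1. -/

import Mathlib

/- A word over alphabet `α` is modelled as `w : ℕ → α`, indexed `w 1, …, w n`. -/

/-- `IsBorder w i b`: `b` is the length of a border (possibly non-proper) of the
prefix `w[1..i]`, i.e. `b ≤ i` and `w[1..b] = w[i-b+1..i]`. -/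
def IsBorder {α : Type*} (w : ℕ → α) (i b : ℕ) : Prop :=
  b ≤ i ∧ ∀ t, 1 ≤ t → t ≤ b → w t = w (i - b + t)

/-- The failure function (border array) `π_w[i]`: the length of the longest proper
border of `w[1..i]`. -/
noncomputable def piF {α : Type*} (w : ℕ → α) (i : ℕ) : ℕ :=
  sSup {b | b < i ∧ IsBorder w i b}

/- The strong failure function `π'_w[i]` of a word of length `n`, valued in `ℤ`:
`π'_w[n] = π_w[n]`, and for `i < n` the length of the longest proper border `b` of
`w[1..i]` with `w[b+1] ≠ w[i+1]`, or `-1` if no such border exists. -/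
open Classical in
noncomputable def piF' {α : Type*} (w : ℕ → α) (n i : ℕ) : ℤ :=
  if i = n then (piF w i : ℤ)
  else if ({b | b < i ∧ IsBorder w i b ∧ w (b + 1) ≠ w (i + 1)} : Set ℕ).Nonempty
    then ((sSup {b | b < i ∧ IsBorder w i b ∧ w (b + 1) ≠ w (i + 1)} : ℕ) : ℤ)
    else -1

/-- `f(i) = π_w[i-1] + 1` (meaningful for `2 ≤ i`). -/
noncomputable def fF {α : Type*} (w : ℕ → α) (i : ℕ) : ℕ := piF w (i - 1) + 1

/-- `fDef w i k`: the iterate `f^{(k)}(i)` is defined, i.e. all the arguments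
`i = f^{(0)}(i), f^{(1)}(i), …, f^{(k-1)}(i)` are `≥ 2`. -/
def fDef {α : Type*} (w : ℕ → α) (i k : ℕ) : Prop := ∀ j < k, 2 ≤ (fF w)^[j] i

/-- `f'(i) = π'_w[i-1] + 1` (meaningful when `2 ≤ i` and `π'_w[i-1] ≥ 0`). -/
noncomputable def fF' {α : Type*} (w : ℕ → α) (n i : ℕ) : ℕ :=
  (piF' w n (i - 1) + 1).toNat

/-- `fDef' w n i k`: the iterate `f'^{(k)}(i)` is defined, i.e. all the intermediate
arguments are `≥ 2` and the corresponding values of `π'` are `≥ 0`. -/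
def fDef' {α : Type*} (w : ℕ → α) (n i k : ℕ) : Prop :=
  ∀ j < k, 2 ≤ (fF' w n)^[j] i ∧ 0 ≤ piF' w n ((fF' w n)^[j] i - 1)

lemma IsBorder.trans {α : Type*} {w : ℕ → α} {i b c : ℕ} (h : IsBorder w i b)
    (h' : IsBorder w b c) : IsBorder w i c := by
  obtain ⟨hb, hw⟩ := h
  obtain ⟨hc, hw'⟩ := h'
  refine ⟨hc.trans hb, fun t h1 h2 => ?_⟩
  rw [hw' t h1 h2, hw (b - c + t) (by omega) (by omega)]
  congr 1
  omega

lemma IsBorder.of_le {α : Type*} {w : ℕ → α} {i b c : ℕ} (h : IsBorder w i b)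
    (h' : IsBorder w i c) (hcb : c ≤ b) : IsBorder w b c := by
  obtain ⟨hb, hw⟩ := h
  obtain ⟨hc, hw'⟩ := h'
  refine ⟨hcb, fun t h1 h2 => ?_⟩
  rw [hw' t h1 h2, hw (b - c + t) (by omega) (by omega)]
  congr 1
  omega

lemma isBorder_succ_succ {α : Type*} {w : ℕ → α} {i b : ℕ} :
    IsBorder w (i + 1) (b + 1) ↔ IsBorder w i b ∧ w (b + 1) = w (i + 1) := by
  constructor
  · rintro ⟨hb, hw⟩
    refine ⟨⟨by omega, fun t h1 h2 => ?_⟩, ?_⟩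
    · rw [hw t h1 (by omega)]
      congr 1
      omega
    · rw [hw (b + 1) (by omega) le_rfl]
      congr 1
      omega
  · rintro ⟨⟨hb, hw⟩, he⟩
    refine ⟨by omega, fun t h1 h2 => ?_⟩
    rcases Nat.lt_or_ge b t with h | h
    · obtain rfl : t = b + 1 := by omega
      rw [he]
      congr 1
      omega
    · rw [hw t h1 h]
      congr 1
      omega

lemma le_piF {α : Type*} {w : ℕ → α} {i b : ℕ} (hb : b < i) (h : IsBorder w i b) :
    b ≤ piF w i :=
  le_csSup ⟨i, fun _ hc => hc.1.le⟩ ⟨hb, h⟩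

lemma piF_spec {α : Type*} (w : ℕ → α) {i : ℕ} (hi : 0 < i) :
    piF w i < i ∧ IsBorder w i (piF w i) :=
  Nat.sSup_mem (s := {b | b < i ∧ IsBorder w i b})
    ⟨0, hi, Nat.zero_le _, fun _ _ _ => by omega⟩ ⟨i, fun _ hc => hc.1.le⟩

/-- If some proper border of `w[1..i]` is followed by a letter other than `w[i+1]`, then
`π'_w[i]` is the largest such border. -/
lemma piF'_spec {α : Type*} {w : ℕ → α} {n i b : ℕ} (hi : i < n) (hb : b < i)
    (h : IsBorder w i b) (hne : w (b + 1) ≠ w (i + 1)) :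
    ∃ c : ℕ, piF' w n i = c ∧ b ≤ c ∧ c < i ∧ IsBorder w i c := by
  have hS : ({b | b < i ∧ IsBorder w i b ∧ w (b + 1) ≠ w (i + 1)} : Set ℕ).Nonempty :=
    ⟨b, hb, h, hne⟩
  have hB : BddAbove {b | b < i ∧ IsBorder w i b ∧ w (b + 1) ≠ w (i + 1)} :=
    ⟨i, fun _ hc => hc.1.le⟩
  have hmem := Nat.sSup_mem hS hB
  refine ⟨_, ?_, le_csSup hB ⟨hb, h, hne⟩, hmem.1, hmem.2.1⟩
  rw [piF', if_neg hi.ne, if_pos hS]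

/-- If `j + 1` exceeds `π_w[m+1]` and `j` is a proper border of `w[1..m]`,
then `w[j+1] ≠ w[m+1]`. -/
lemma ne_of_piF_lt {α : Type*} {w : ℕ → α} {m j : ℕ} (hj : j < m) (hb : IsBorder w m j)
    (h : piF w (m + 1) < j + 1) : w (j + 1) ≠ w (m + 1) := fun he =>
  absurd (le_piF (by omega) (isBorder_succ_succ.2 ⟨hb, he⟩)) (by omega)

lemma fF'_succ {α : Type*} {w : ℕ → α} {n j c : ℕ} (h : piF' w n j = c) :
    fF' w n (j + 1) = c + 1 := by
  rw [fF', Nat.add_sub_cancel, h]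
  omega

lemma fDef'_succ {α : Type*} {w : ℕ → α} {n i k : ℕ} (hi : 2 ≤ i)
    (h0 : 0 ≤ piF' w n (i - 1)) (h : fDef' w n (fF' w n i) k) : fDef' w n i (k + 1) := by
  intro j hj
  cases j with
  | zero => exact ⟨hi, h0⟩
  | succ j => exact h j (by omega)

/-- Iterating `f'` from any proper border of `w[1..m]` extended by one letter and of length at
least `π_w[m+1] = p + 1` reaches `π_w[m+1]`. -/
lemma exists_iterate_fF'_eq {α : Type*} {w : ℕ → α} {n m p : ℕ} (hm : m < n)
    (hp : piF w (m + 1) = p + 1) (j : ℕ) (hpj : p ≤ j) (hjm : j < m) (hb : IsBorder w m j) :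
    ∃ k, fDef' w n (j + 1) k ∧ p + 1 = (fF' w n)^[k] (j + 1) := by
  induction j using Nat.strong_induction_on with
  | _ j ih =>
    rcases hpj.eq_or_lt with rfl | hlt
    · exact ⟨0, fun _ h => absurd h (by omega), rfl⟩
    have hpb := (piF_spec w (Nat.succ_pos m)).2
    rw [Nat.succ_eq_add_one, hp, isBorder_succ_succ] at hpb
    have hne := ne_of_piF_lt hjm hb (by omega)
    obtain ⟨c, hc, hpc, hcj, hcb⟩ := piF'_spec (hjm.trans hm) hlt (hb.of_le hpb.1 hpj)
      (by rw [hpb.2]; exact hne.symm)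
    obtain ⟨k, hk, he⟩ := ih c hcj hpc (hcj.trans hjm) (hb.trans hcb)
    refine ⟨k + 1, fDef'_succ (by omega) (by simp [hc]) (by rwa [fF'_succ hc]), ?_⟩
    rw [Function.iterate_succ_apply, fF'_succ hc, he]

/-- For every `2 ≤ i ≤ n`, either `π_w[i] = f(i)`, or `π_w[i] = 0`, or
`π_w[i] = f'^{(k)}(i)` for some `k ≥ 1`. -/
theorem pi_is_usually_pi' {α : Type*} (w : ℕ → α) (n i : ℕ) (h1 : 2 ≤ i) (h2 : i ≤ n) :
    piF w i = fF w i ∨ piF w i = 0 ∨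
      ∃ k, 1 ≤ k ∧ fDef' w n i k ∧ piF w i = (fF' w n)^[k] i := by
  obtain ⟨m, rfl⟩ : ∃ m, i = m + 1 := ⟨i - 1, by omega⟩
  refine or_iff_not_imp_left.2 fun hf => or_iff_not_imp_left.2 fun h0 => ?_
  obtain ⟨p, hp⟩ := Nat.exists_eq_succ_of_ne_zero h0
  rw [Nat.succ_eq_add_one] at hp
  rw [fF, Nat.add_sub_cancel, hp] at hf
  obtain ⟨hpm, hpb⟩ := piF_spec w (Nat.succ_pos m)
  rw [Nat.succ_eq_add_one, hp] at hpm hpb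
  rw [isBorder_succ_succ] at hpb
  obtain ⟨hqm, hqb⟩ := piF_spec w (show 0 < m by omega)
  have hpq := le_piF (by omega) hpb.1
  obtain ⟨c, hc, hqc, hcm, hcb⟩ := piF'_spec (by omega : m < n) hqm hqb
    (ne_of_piF_lt hqm hqb (by omega))
  obtain ⟨k, hk, he⟩ := exists_iterate_fF'_eq (n := n) (by omega) hp c (hpq.trans hqc) hcm hcb
  refine ⟨k + 1, by omega, fDef'_succ h1 (by simp [hc]) (by rwa [fF'_succ hc]), ?_⟩
  rw [Function.iterate_succ_apply, fF'_succ hc, hp, he]
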